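/- Let d ≥ 3. There exist constants c_3 > 0 and c' > 0 depending only on d such that for every integer L_0 ≥ c', every n ≥ 0 and every integer r ≥ 1, with V, U, and the return times R_k as below, Σ_{x} e_V(x) · P_x[ R_{r+1} < ∞ ] ≤ cap(V) · (c_3 / ℓ_n^{d−2})^r. -/

import Mathlib

open MeasureTheory Filter

namespace RI

/-- Points of `ℤ^d`. -/
abbrev Zd (d : ℕ) := Fin d → ℤ

/-- `x` and `y` are nearest neighbours: `|x - y| = 1`. -/
def adj {d : ℕ} (x y : Zd d) : Prop := (∑ i, |x i - y i|) = 1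

/-- `x` and `y` are `*`-neighbours: `|x - y|_∞ = 1`. -/
def starAdj {d : ℕ} (x y : Zd d) : Prop := x ≠ y ∧ ∀ i, |x i - y i| ≤ 1

/-- `x` belongs to the plane `ℤ e₁ + ℤ e₂ ⊆ ℤ^d`. -/
def inPlane {d : ℕ} (x : Zd d) : Prop := ∀ i : Fin d, 2 ≤ (i : ℕ) → x i = 0

/-- The `k`-th coordinate of `x`, with value `0` for out-of-range indices. -/
def coord {d : ℕ} (x : Zd d) (k : ℕ) : ℤ := if h : k < d then x ⟨k, h⟩ else 0

/-- `P` is the family of laws of the simple random walks on `ℤ^d` started at the points of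
`ℤ^d`: each `P x` is a probability measure on the path space `ℕ → ℤ^d`, and the cylinder
probabilities are those of the walk with i.i.d. increments uniform on `{± e_i}`. -/
def IsSRW (d : ℕ) (P : Zd d → Measure (ℕ → Zd d)) : Prop :=
  (∀ x, IsProbabilityMeasure (P x)) ∧
  (∀ (x : Zd d) (n : ℕ) (w : ℕ → Zd d),
      (w 0 = x ∧ ∀ k < n, adj (w k) (w (k + 1))) →
        P x {ω | ∀ k ≤ n, ω k = w k} = ((2 * d : ENNReal))⁻¹ ^ n) ∧
  (∀ (x : Zd d) (n : ℕ) (w : ℕ → Zd d),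
      ¬(w 0 = x ∧ ∀ k < n, adj (w k) (w (k + 1))) →
        P x {ω | ∀ k ≤ n, ω k = w k} = 0)

/-- The equilibrium measure of a set `V ⊆ ℤ^d`:
`e_V(x) = P_x[H̃_V = ∞]` for `x ∈ V`, and `0` otherwise. -/
noncomputable def eqm {d : ℕ} (P : Zd d → Measure (ℕ → Zd d)) (V : Set (Zd d)) : Zd d → ℝ :=
  V.indicator fun x => (P x {ω | ∀ n, 1 ≤ n → ω n ∉ V}).toReal

/-- The capacity of a finite set `K ⊆ ℤ^d`. -/
noncomputable def capa {d : ℕ} (P : Zd d → Measure (ℕ → Zd d)) (K : Finset (Zd d)) : ℝ :=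
  ∑ x ∈ K, eqm P (↑K) x

/-- `Q` is a vacant-set law at level `u`: a probability measure on `{0,1}^{ℤ^d}`
(with `true = 1` standing for "vacant") such that
`Q[Y_x = 1 ∀ x ∈ K] = exp(-u cap K)` for every finite `K`. -/
def IsVacantLaw {d : ℕ} (P : Zd d → Measure (ℕ → Zd d)) (u : ℝ)
    (Q : Measure (Zd d → Bool)) : Prop :=
  IsProbabilityMeasure Q ∧
  ∀ K : Finset (Zd d),
    Q {Y | ∀ x ∈ K, Y x = true} = ENNReal.ofReal (Real.exp (-(u * capa P K)))

/-- There is a `*`-path starting in `S`, ending in `T`, all of whose points lie in `A`. -/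
def HasStarPath {d : ℕ} (S T A : Set (Zd d)) : Prop :=
  ∃ (N : ℕ) (w : ℕ → Zd d), w 0 ∈ S ∧ w N ∈ T ∧ (∀ k ≤ N, w k ∈ A) ∧
    ∀ k < N, starAdj (w k) (w (k + 1))

/-- Interior boundary `∂_int U`. -/
def intBdry {d : ℕ} (U : Set (Zd d)) : Set (Zd d) := {x | x ∈ U ∧ ∃ y, y ∉ U ∧ adj x y}

/-- (Exterior) boundary `∂U`. -/
def bdry {d : ℕ} (U : Set (Zd d)) : Set (Zd d) := {x | x ∉ U ∧ ∃ y ∈ U, adj x y}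

/-- `ℓ = 100 ⌊L^{1/100}⌋ + 1`. -/
noncomputable def ellOf (L : ℕ) : ℕ := 100 * ⌊(L : ℝ) ^ ((1 : ℝ) / 100)⌋₊ + 1

/-- The scales `L_{n+1} = ℓ_n L_n`. -/
noncomputable def Lseq (L0 : ℕ) : ℕ → ℕ
  | 0 => L0
  | n + 1 => ellOf (Lseq L0 n) * Lseq L0 n

/-- The levels `u_{n+1} = (1 + 1/log L_n)⁻¹ u_n`. -/
noncomputable def useq (L0 : ℕ) (u0 : ℝ) : ℕ → ℝ
  | 0 => u0
  | n + 1 => (1 + 1 / Real.log (Lseq L0 n))⁻¹ * useq L0 u0 n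

/-- The event (on the configuration space `{0,1}^{ℤ^d}`) that there is a `*`-path from
`[-L,L]² ∩ ℤ²` to `∂_int ([-3L,3L]^d ∩ ℤ^d)` all of whose points lie in `{x ∈ ℤ² : Y_x = 0}`. -/
def qEvent (d : ℕ) (L : ℕ) : Set (Zd d → Bool) :=
  {Y | HasStarPath
    {x : Zd d | inPlane x ∧ ∀ i, |x i| ≤ (L : ℤ)}
    (intBdry {x : Zd d | ∀ i, |x i| ≤ (3 * L : ℤ)})
    {x : Zd d | inPlane x ∧ Y x = false}}


/-- The embedding of `ℤ²` into `ℤ^d`. -/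
def embPlane (d : ℕ) (i : ℤ × ℤ) : Zd d :=
  fun j => if (j : ℕ) = 0 then i.1 else if (j : ℕ) = 1 then i.2 else 0

/-- `V = (([-3Lₙ,3Lₙ]^d + 2Lₙ i₁) ∪ ([-3Lₙ,3Lₙ]^d + 2Lₙ i₂)) ∩ ℤ^d`. -/
def twoBoxV (d : ℕ) (Ln : ℕ) (i1 i2 : ℤ × ℤ) : Set (Zd d) :=
  {x | ∀ j, |x j - 2 * (Ln : ℤ) * embPlane d i1 j| ≤ 3 * (Ln : ℤ)} ∪
  {x | ∀ j, |x j - 2 * (Ln : ℤ) * embPlane d i2 j| ≤ 3 * (Ln : ℤ)}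

/-- `U = {z : d(z,V) ≤ L_{n+1}/10}`, the `ℓ^∞`-neighbourhood of `V` of size `L_{n+1}/10`. -/
def nbhdU (d : ℕ) (L1 : ℕ) (V : Set (Zd d)) : Set (Zd d) :=
  {z | ∃ v ∈ V, ∀ j, 10 * |z j - v j| ≤ (L1 : ℤ)}


/-- The Finset version of `twoBoxV`. -/
noncomputable def twoBoxVF (d : ℕ) (Ln : ℕ) (i1 i2 : ℤ × ℤ) : Finset (Zd d) :=
  (Fintype.piFinset fun j => Finset.Icc (2 * (Ln : ℤ) * embPlane d i1 j - 3 * (Ln : ℤ))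
      (2 * (Ln : ℤ) * embPlane d i1 j + 3 * (Ln : ℤ))) ∪
  (Fintype.piFinset fun j => Finset.Icc (2 * (Ln : ℤ) * embPlane d i2 j - 3 * (Ln : ℤ))
      (2 * (Ln : ℤ) * embPlane d i2 j + 3 * (Ln : ℤ)))

/-- First time `≥ t` at which the path is in `A` (`∞` if there is none or if `t = ∞`). -/
noncomputable def nextIn {d : ℕ} (A : Set (Zd d)) (ω : ℕ → Zd d) (t : ℕ∞) : ℕ∞ :=
  ⨅ (m : ℕ) (_ : t ≤ (m : ℕ∞) ∧ ω m ∈ A), (m : ℕ∞)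

/-- First time `≥ t` at which the path is outside `A` (`∞` if there is none or `t = ∞`). -/
noncomputable def nextOut {d : ℕ} (A : Set (Zd d)) (ω : ℕ → Zd d) (t : ℕ∞) : ℕ∞ :=
  ⨅ (m : ℕ) (_ : t ≤ (m : ℕ∞) ∧ ω m ∉ A), (m : ℕ∞)

/-- The successive return times to `V` and departure times from `U`:
`(RD V U ω k).1 = R_k` and `(RD V U ω k).2 = D_k` for `k ≥ 1`
(with the convention `R_0 = D_0 = 0`). -/
noncomputable def RD {d : ℕ} (V U : Set (Zd d)) (ω : ℕ → Zd d) : ℕ → ℕ∞ × ℕ∞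
  | 0 => (0, 0)
  | k + 1 =>
      let r := nextIn V ω (RD V U ω k).2
      (r, nextOut U ω r)

/-- `w` (of length `N`) belongs to the collection `𝒯` of paths started in `V`,
staying in `U` and ending on `∂U`. -/
def inT {d : ℕ} (V U : Set (Zd d)) (N : ℕ) (w : ℕ → Zd d) : Prop :=
  w 0 ∈ V ∧ w N ∈ bdry U ∧ (∀ i < N, w i ∈ U) ∧ ∀ i < N, adj (w i) (w (i + 1))


end RI

open RI MeasureTheory Filter

namespace RI

/-- The fourth-order Taylor upper bound for `y ↦ (1 + y) ^ (-s)` near `0`. -/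
lemma one_add_rpow_neg_le {s y : ℝ} (hs : 0 < s) (hy : |y| * (s + 4) ≤ 1) :
    (1 + y) ^ (-s) ≤ 1 - s * y + s * (s + 1) / 2 * y ^ 2 - s * (s + 1) * (s + 2) / 6 * y ^ 3
      + s * (s + 1) * (s + 2) * (s + 3) / 18 * y ^ 4 := by
  set T : ℝ → ℝ := fun y => 1 - s * y + s * (s + 1) / 2 * y ^ 2
    - s * (s + 1) * (s + 2) / 6 * y ^ 3 + s * (s + 1) * (s + 2) * (s + 3) / 18 * y ^ 4 with hT
  set δ : ℝ := 1 / (s + 4) with hδ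
  have hs4 : 0 < s + 4 := by linarith
  have hδ0 : 0 < δ := by positivity
  have hδ1 : δ < 1 := by rw [hδ, div_lt_one hs4]; linarith
  have hδs : δ * (s + 4) = 1 := by rw [hδ]; field_simp
  have hyδ : |y| ≤ δ := by rw [hδ, le_div_iff₀ hs4]; exact hy
  have hderiv : ∀ z : ℝ, |z| ≤ δ → HasDerivAt (fun z => T z * (1 + z) ^ s)
      ((1 + z) ^ (s - 1) * (s * (s + 1) * (s + 2) * (s + 3) / 18 *
        (1 + (s + 4) * z)) * z ^ 3) z := by
    intro z hz
    have hz' := abs_le.1 hz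
    have h1 : 0 < 1 + z := by linarith
    have hTd : HasDerivAt T (-s + s * (s + 1) * z - s * (s + 1) * (s + 2) / 2 * z ^ 2
        + s * (s + 1) * (s + 2) * (s + 3) / 18 * (4 * z ^ 3)) z := by
      have := (((((hasDerivAt_id z).const_mul s).const_sub 1).add
        (((hasDerivAt_id z).pow 2).const_mul (s * (s + 1) / 2))).sub
        (((hasDerivAt_id z).pow 3).const_mul (s * (s + 1) * (s + 2) / 6))).add
        (((hasDerivAt_id z).pow 4).const_mul (s * (s + 1) * (s + 2) * (s + 3) / 18))
      refine this.congr_deriv ?_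
      simp
      ring
    have hpow := ((hasDerivAt_id z).const_add 1).rpow_const (p := s) (Or.inl h1.ne')
    refine (hTd.mul hpow).congr_deriv ?_
    have hsplit : (1 + z) ^ s = (1 + z) ^ (s - 1) * (1 + z) := by
      rw [← Real.rpow_add_one h1.ne']; ring_nf
    simp only [id, hsplit, hT]
    ring
  have hcont : ContinuousOn (fun z => T z * (1 + z) ^ s) (Set.Icc (-δ) δ) := fun z hz =>
    (hderiv z (abs_le.2 hz)).continuousAt.continuousWithinAt
  have hfac : ∀ z : ℝ, |z| ≤ δ → 0 ≤ (1 + z) ^ (s - 1) * (s * (s + 1) * (s + 2) * (s + 3) / 18 *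
        (1 + (s + 4) * z)) := by
    intro z hz
    have hz' := abs_le.1 hz
    have h1 : 0 ≤ 1 + z := by linarith
    have h2 : 0 ≤ 1 + (s + 4) * z := by nlinarith
    positivity
  have hone : 1 ≤ T y * (1 + y) ^ s := by
    have h0 : T 0 * (1 + 0) ^ s = 1 := by simp [hT]
    refine h0.symm.le.trans ?_
    have hy' := abs_le.1 hyδ
    rcases le_total 0 y with hy0 | hy0
    · refine monotoneOn_of_deriv_nonneg (convex_Icc 0 δ)
        (hcont.mono (Set.Icc_subset_Icc_left (by linarith))) ?_ ?_
        (Set.left_mem_Icc.2 hδ0.le) ⟨hy0, hy'.2⟩ hy0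
      · intro z hz
        rw [interior_Icc] at hz
        exact (hderiv z (abs_le.2 ⟨by linarith [hz.1], hz.2.le⟩)).differentiableAt
          |>.differentiableWithinAt
      · intro z hz
        rw [interior_Icc] at hz
        have hz' : |z| ≤ δ := abs_le.2 ⟨by linarith [hz.1], hz.2.le⟩
        rw [(hderiv z hz').deriv]
        exact mul_nonneg (hfac z hz') (pow_nonneg hz.1.le 3)
    · refine antitoneOn_of_deriv_nonpos (convex_Icc (-δ) 0)
        (hcont.mono (Set.Icc_subset_Icc_right hδ0.le)) ?_ ?_
        ⟨hy'.1, hy0⟩ (Set.right_mem_Icc.2 (by linarith)) hy0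
      · intro z hz
        rw [interior_Icc] at hz
        exact (hderiv z (abs_le.2 ⟨hz.1.le, by linarith [hz.2]⟩)).differentiableAt
          |>.differentiableWithinAt
      · intro z hz
        rw [interior_Icc] at hz
        have hz' : |z| ≤ δ := abs_le.2 ⟨hz.1.le, by linarith [hz.2]⟩
        rw [(hderiv z hz').deriv]
        exact mul_nonpos_of_nonneg_of_nonpos (hfac z hz')
          (Odd.pow_nonpos (by decide) hz.2.le)
  have h1y : 0 < 1 + y := by linarith [(abs_le.1 hyδ).1]
  rw [Real.rpow_neg h1y.le, inv_eq_one_div, div_le_iff₀ (Real.rpow_pos_of_pos h1y s)]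
  exact hone

/-- The squared Euclidean norm of a lattice point. -/
def nsq {d : ℕ} (x : Zd d) : ℝ := ∑ j, (x j : ℝ) ^ 2

lemma nsq_nonneg {d : ℕ} (x : Zd d) : 0 ≤ nsq x := Finset.sum_nonneg fun _ _ => sq_nonneg _

lemma sq_le_nsq {d : ℕ} (x : Zd d) (i : Fin d) : (x i : ℝ) ^ 2 ≤ nsq x :=
  Finset.single_le_sum (f := fun j => (x j : ℝ) ^ 2) (fun _ _ => sq_nonneg _) (Finset.mem_univ i)

lemma nsq_add_single {d : ℕ} (x : Zd d) (i : Fin d) (a : ℤ) :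
    nsq (x + Pi.single i a) = nsq x + (a : ℝ) ^ 2 + 2 * a * x i := by
  have h : ∀ j, (((x + Pi.single i a : Zd d) j : ℤ) : ℝ) ^ 2
      = (x j : ℝ) ^ 2 + if j = i then (a : ℝ) ^ 2 + 2 * a * x i else 0 := by
    intro j
    by_cases hj : j = i
    · subst hj; simp; ring
    · simp [hj]
  simp only [nsq, h, Finset.sum_add_distrib, Finset.sum_ite_eq', Finset.mem_univ, if_true]
  ring

/-- The exponent `(d - 2) / 2`. -/
noncomputable def sExp (d : ℕ) : ℝ := ((d : ℝ) - 2) / 2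

/-- The regularising constant in the superharmonic function `potential`. -/
noncomputable def regConst (d : ℕ) : ℝ := (sExp d + 4) ^ 2 * (d + 40)

/-- The function `(|x|² + A)^{-(d-2)/2}`, superharmonic for the simple random walk. -/
noncomputable def potential {d : ℕ} (x : Zd d) : ℝ := (nsq x + regConst d) ^ (-sExp d)

lemma sExp_pos {d : ℕ} (hd : 3 ≤ d) : 0 < sExp d := by
  have : (3 : ℝ) ≤ d := by exact_mod_cast hd
  unfold sExp; linarith

lemma regConst_pos {d : ℕ} (hd : 3 ≤ d) : 0 < regConst d := by
  have := sExp_pos hd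
  unfold regConst; positivity

lemma potential_superharmonic {d : ℕ} (hd : 3 ≤ d) (x : Zd d) :
    ∑ i, (potential (x + Pi.single i 1) + potential (x + Pi.single i (-1)))
      ≤ 2 * d * potential x := by
  have hs := sExp_pos hd
  have hA := regConst_pos hd
  have hdR : (3 : ℝ) ≤ d := by exact_mod_cast hd
  set s := sExp d with hsdef
  have hds : (d : ℝ) = 2 * s + 2 := by rw [hsdef, sExp]; ring
  set A := regConst d with hAdef
  have hAeq : A = (s + 4) ^ 2 * (d + 40) := rfl
  set q := nsq x + A with hq
  have hn := nsq_nonneg x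
  have hq0 : 0 < q := by linarith
  have hA16 : 16 * (s + 4) ^ 2 ≤ A := by rw [hAeq]; nlinarith [sq_nonneg (s + 4)]
  set u := 1 / q with hu
  have hu0 : 0 < u := by positivity
  have hqu : q * u = 1 := by rw [hu]; field_simp
  have huA : 16 * (s + 4) ^ 2 * u ≤ 1 := by
    rw [← hqu]; gcongr; linarith
  have hu1 : u ≤ 1 := by nlinarith [sq_nonneg s]
  set t : Fin d → ℝ := fun i => 2 * x i * u with ht
  have htsq : ∀ i, t i ^ 2 ≤ 4 * u := by
    intro i
    have := sq_le_nsq x i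
    have h2 : (x i : ℝ) ^ 2 * u ≤ 1 := by rw [← hqu]; gcongr; linarith
    simp only [ht]; nlinarith
  have hsum : ∑ i, t i ^ 2 = 4 * u - 4 * A * u ^ 2 := by
    have : ∀ i, t i ^ 2 = 4 * u ^ 2 * (x i : ℝ) ^ 2 := fun i => by simp only [ht]; ring
    simp only [this, ← Finset.mul_sum]
    change 4 * u ^ 2 * nsq x = _
    have : nsq x = q - A := by rw [hq]; ring
    rw [this]
    linear_combination 4 * u * hqu
  set C := s * (s + 1) * (s + 2) * (s + 3) / 18 with hC
  have hC0 : 0 < C := by positivity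
  have hsmall : ∀ i, |u + t i| * (s + 4) ≤ 1 ∧ |u + -t i| * (s + 4) ≤ 1 := by
    intro i
    have h1 : |t i| * (s + 4) ≤ 1 / 2 := by
      apply abs_le_of_sq_le_sq' _ (by norm_num) |>.2
      rw [mul_pow, sq_abs]
      nlinarith [htsq i, sq_nonneg (s + 4)]
    have h2 : |u| * (s + 4) ≤ 1 / 2 := by rw [abs_of_pos hu0]; nlinarith
    have h3 := abs_add_le u (t i)
    have h4 := abs_add_le u (-t i)
    rw [abs_neg] at h4
    constructor <;> nlinarith
  have hpot : ∀ y : ℝ, |y| * (s + 4) ≤ 1 → (q * (1 + y)) ^ (-s) = q ^ (-s) * (1 + y) ^ (-s) := by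
    intro y hy
    have : |y| ≤ 1 := by nlinarith [abs_nonneg y]
    exact Real.mul_rpow hq0.le (by linarith [(abs_le.1 this).1])
  have hterm : ∀ i, potential (x + Pi.single i 1) + potential (x + Pi.single i (-1))
      ≤ q ^ (-s) * (2 - 2 * s * u + s * (s + 1) * (u ^ 2 + t i ^ 2) + 2 * C * u ^ 2
        + C * (12 * u ^ 2 * t i ^ 2 + 8 * u * t i ^ 2)) := by
    intro i
    have e1 : nsq (x + Pi.single i 1) + A = q * (1 + (u + t i)) := by
      rw [nsq_add_single]; simp only [ht]; push_cast
      linear_combination (-1 - 2 * (x i : ℝ)) * hqu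
    have e2 : nsq (x + Pi.single i (-1)) + A = q * (1 + (u + -t i)) := by
      rw [nsq_add_single]; simp only [ht]; push_cast
      linear_combination (-1 + 2 * (x i : ℝ)) * hqu
    unfold potential
    rw [← hAdef, ← hsdef, e1, e2, hpot _ (hsmall i).1, hpot _ (hsmall i).2, ← mul_add]
    refine mul_le_mul_of_nonneg_left ?_ (Real.rpow_nonneg hq0.le _)
    have b1 := one_add_rpow_neg_le hs (hsmall i).1
    have b2 := one_add_rpow_neg_le hs (hsmall i).2
    rw [← hC] at b1 b2
    have hu4 : u ^ 4 ≤ u ^ 2 := pow_le_pow_of_le_one hu0.le hu1 (by norm_num)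
    have ht4 : t i ^ 4 ≤ 4 * u * t i ^ 2 := by nlinarith [htsq i, sq_nonneg (t i)]
    have hcub : 0 ≤ s * (s + 1) * (s + 2) / 6 * (2 * u ^ 3 + 6 * u * t i ^ 2) := by positivity
    have h5 : C * u ^ 4 ≤ C * u ^ 2 := by gcongr
    have h6 : C * t i ^ 4 ≤ C * (4 * u * t i ^ 2) := by gcongr
    linear_combination b1 + b2 + hcub + 2 * h5 + 2 * h6
  refine (Finset.sum_le_sum fun i _ => hterm i).trans ?_
  rw [← Finset.mul_sum]
  change _ ≤ 2 * d * q ^ (-s)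
  rw [mul_comm (2 * (d : ℝ))]
  refine mul_le_mul_of_nonneg_left ?_ (Real.rpow_nonneg hq0.le _)
  have hexp : ∑ i, (2 - 2 * s * u + s * (s + 1) * (u ^ 2 + t i ^ 2) + 2 * C * u ^ 2
        + C * (12 * u ^ 2 * t i ^ 2 + 8 * u * t i ^ 2))
      = d * (2 - 2 * s * u + s * (s + 1) * u ^ 2 + 2 * C * u ^ 2)
        + (s * (s + 1) + C * (12 * u ^ 2 + 8 * u)) * ∑ i, t i ^ 2 := by
    have hconst : ∀ c : ℝ, d * c = ∑ _i : Fin d, c := fun c => by simp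
    rw [Finset.mul_sum, hconst, ← Finset.sum_add_distrib]
    exact Finset.sum_congr rfl fun i _ => by ring
  rw [hexp]
  have hmain : (s * (s + 1) + C * (12 * u ^ 2 + 8 * u)) * ∑ i, t i ^ 2
      ≤ s * (s + 1) * (4 * u - 4 * A * u ^ 2) + 80 * C * u ^ 2 := by
    have h1 : C * (12 * u ^ 2 + 8 * u) * ∑ i, t i ^ 2 ≤ C * (20 * u) * (4 * u) := by
      gcongr
      · linear_combination 12 * u * hu1
      · have : 0 ≤ 4 * A * u ^ 2 := by positivity
        linarith
    linear_combination h1 + s * (s + 1) * hsum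
  have hfin : d * (s * (s + 1)) + 2 * C * d + 80 * C ≤ s * (s + 1) * (4 * A) := by
    have : d * (s * (s + 1)) + 2 * C * d + 80 * C
        = s * (s + 1) * (d + (s + 2) * (s + 3) * (d + 40) / 9) := by rw [hC]; ring
    rw [this]
    gcongr
    rw [hAeq]
    have h1 : (s + 2) * (s + 3) * (d + 40) ≤ (s + 4) ^ 2 * (d + 40) := by
      gcongr
      nlinarith only [hs]
    have h2 : 1 * ((d : ℝ) + 40) ≤ (s + 4) ^ 2 * (d + 40) := by
      gcongr
      nlinarith only [hs]
    linarith
  linear_combination hmain + u ^ 2 * hfin - 2 * s * u * hds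

/-- A neighbour of `x` is of the form `x ± e_i`. -/
lemma adj.exists_single {d : ℕ} {x y : Zd d} (h : adj x y) :
    ∃ i, y = x + Pi.single i 1 ∨ y = x + Pi.single i (-1) := by
  unfold adj at h
  have hne : ∃ i, x i - y i ≠ 0 := by
    by_contra! h0
    simp [h0] at h
  obtain ⟨i, hi⟩ := hne
  have hsplit := Finset.add_sum_erase Finset.univ (fun j => |x j - y j|) (Finset.mem_univ i)
  have hpos : 1 ≤ |x i - y i| := Int.one_le_abs hi
  have hnn : ∀ j ∈ Finset.univ.erase i, 0 ≤ |x j - y j| := fun j _ => abs_nonneg _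
  have hrest : ∑ j ∈ Finset.univ.erase i, |x j - y j| = 0 :=
    le_antisymm (by omega) (Finset.sum_nonneg hnn)
  have hi1 : |x i - y i| = 1 := by omega
  have hoff : ∀ j, j ≠ i → y j = x j := fun j hj => by
    have := (Finset.sum_eq_zero_iff_of_nonneg hnn).1 hrest j (by simp [hj])
    rw [abs_eq_zero] at this
    omega
  refine ⟨i, ?_⟩
  rcases (abs_eq one_pos.le).1 hi1 with h1 | h1
  · right
    ext j
    by_cases hj : j = i
    · subst hj; simp; omega
    · simp [hj, hoff j hj]
  · left
    ext j
    by_cases hj : j = i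
    · subst hj; simp; omega
    · simp [hj, hoff j hj]

/-- The sum of `h` over the neighbours of `x`. -/
noncomputable def nbrSum {d : ℕ} (h : Zd d → ENNReal) (x : Zd d) : ENNReal :=
  ∑ i, (h (x + Pi.single i 1) + h (x + Pi.single i (-1)))

open Classical in
lemma tsum_adj_le {d : ℕ} (h : Zd d → ENNReal) (x : Zd d) :
    ∑' y, (if adj x y then h y else 0) ≤ nbrSum h x := by
  calc ∑' y, (if adj x y then h y else 0)
      ≤ ∑' y, ∑ i, ((if y = x + Pi.single i 1 then h y else 0)
          + (if y = x + Pi.single i (-1) then h y else 0)) := by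
        refine ENNReal.tsum_le_tsum fun y => ?_
        split_ifs with hxy
        · obtain ⟨i, hi⟩ := hxy.exists_single
          refine le_trans ?_ (Finset.single_le_sum (fun _ _ => zero_le) (Finset.mem_univ i))
          rcases hi with hi | hi
          · rw [if_pos hi]; exact le_self_add
          · rw [if_pos hi]; exact le_add_self
        · exact zero_le
    _ = nbrSum h x := by
        rw [Summable.tsum_finsetSum fun _ _ => ENNReal.summable]
        refine Finset.sum_congr rfl fun i _ => ?_
        rw [ENNReal.tsum_add, tsum_ite_eq, tsum_ite_eq]

/-- The path following `w` for the times `0, …, n` and constant equal to `y` afterwards. -/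
def extendPath {d n : ℕ} (w : Fin (n + 1) → Zd d) (y : Zd d) (k : ℕ) : Zd d :=
  if h : k < n + 1 then w ⟨k, h⟩ else y

lemma extendPath_of_le {d n : ℕ} (w : Fin (n + 1) → Zd d) (y : Zd d) {k : ℕ} (h : k ≤ n) :
    extendPath w y k = w ⟨k, Nat.lt_succ_of_le h⟩ := dif_pos _

lemma extendPath_succ {d n : ℕ} (w : Fin (n + 1) → Zd d) (y : Zd d) :
    extendPath w y (n + 1) = y := dif_neg (lt_irrefl _)

/-- The beginning of a path, up to time `n`. -/
def pastPath {d : ℕ} (n : ℕ) (ω : ℕ → Zd d) : Fin (n + 1) → Zd d := fun k => ω k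

lemma measurable_pastPath {d : ℕ} (n : ℕ) : Measurable (pastPath (d := d) n) :=
  measurable_pi_lambda _ fun _ => measurable_pi_apply _

lemma pastPath_eq_iff {d n : ℕ} {ω : ℕ → Zd d} {w : Fin (n + 1) → Zd d} (y : Zd d) :
    pastPath n ω = w ↔ ∀ k ≤ n, ω k = extendPath w y k := by
  constructor
  · rintro rfl k hk
    rw [extendPath_of_le _ _ hk]; rfl
  · intro h
    ext1 k
    rw [pastPath, h k (Nat.le_of_lt_succ k.2), extendPath_of_le _ _ (Nat.le_of_lt_succ k.2)]

open Classical in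
/-- One-step Markov inequality on cylinders. -/
lemma IsSRW.cylinder_succ_le {d : ℕ} {P : Zd d → Measure (ℕ → Zd d)} (hP : IsSRW d P)
    (x : Zd d) (n : ℕ) (w : ℕ → Zd d) :
    P x {ω | ∀ k ≤ n + 1, ω k = w k} ≤
      if adj (w n) (w (n + 1)) then (2 * d : ENNReal)⁻¹ * P x {ω | ∀ k ≤ n, ω k = w k} else 0 := by
  by_cases h : w 0 = x ∧ ∀ k < n + 1, adj (w k) (w (k + 1))
  · rw [hP.2.1 x (n + 1) w h, if_pos (h.2 n n.lt_succ_self),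
      hP.2.1 x n w ⟨h.1, fun k hk => h.2 k (by omega)⟩, pow_succ']
  · rw [hP.2.2 x (n + 1) w h]
    exact zero_le

/-- One-step Markov inequality for functionals of the past and of the next position. -/
lemma IsSRW.lintegral_step_le {d : ℕ} {P : Zd d → Measure (ℕ → Zd d)} (hP : IsSRW d P)
    (x : Zd d) (n : ℕ) (Φ : (Fin (n + 1) → Zd d) → Zd d → ENNReal) :
    ∫⁻ ω, Φ (pastPath n ω) (ω (n + 1)) ∂P x ≤
      ∫⁻ ω, (2 * d : ENNReal)⁻¹ * nbrSum (Φ (pastPath n ω)) (ω n) ∂P x := by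
  classical
  have hm : Measurable fun ω : ℕ → Zd d => (pastPath n ω, ω (n + 1)) :=
    (measurable_pastPath n).prodMk (measurable_pi_apply _)
  have hL : ∫⁻ ω, Φ (pastPath n ω) (ω (n + 1)) ∂P x
      = ∑' (w : Fin (n + 1) → Zd d) (y : Zd d),
        Φ w y * P x {ω | ∀ k ≤ n + 1, ω k = extendPath w y k} := by
    have := lintegral_map (μ := P x) (f := fun q : (Fin (n + 1) → Zd d) × Zd d => Φ q.1 q.2)
      (measurable_of_countable _) hm
    rw [← this, lintegral_countable', ENNReal.tsum_prod']
    refine tsum_congr fun w => tsum_congr fun y => ?_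
    rw [Measure.map_apply hm (measurableSet_singleton _)]
    congr 2
    ext ω
    simp only [Set.mem_preimage, Set.mem_singleton_iff, Prod.mk.injEq, Set.mem_ofPred_eq,
      pastPath_eq_iff y]
    constructor
    · rintro ⟨h1, h2⟩ k hk
      rcases Nat.lt_or_ge n k with h | h
      · obtain rfl : k = n + 1 := by omega
        rw [h2, extendPath_succ]
      · exact h1 k h
    · intro h
      exact ⟨fun k hk => h k (by omega), by rw [h (n + 1) le_rfl, extendPath_succ]⟩
  have hR : ∫⁻ ω, (2 * d : ENNReal)⁻¹ * nbrSum (Φ (pastPath n ω)) (ω n) ∂P x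
      = ∑' w : Fin (n + 1) → Zd d, (2 * d : ENNReal)⁻¹ * nbrSum (Φ w) (w (Fin.last n))
        * P x {ω | pastPath n ω = w} := by
    have := lintegral_map (μ := P x) (f := fun w : Fin (n + 1) → Zd d =>
      (2 * d : ENNReal)⁻¹ * nbrSum (Φ w) (w (Fin.last n)))
      (measurable_of_countable _) (measurable_pastPath n)
    refine Eq.trans (Eq.trans ?_ this.symm) ?_
    · simp [pastPath]
    · rw [lintegral_countable']
      refine tsum_congr fun w => ?_
      rw [Measure.map_apply (measurable_pastPath n) (measurableSet_singleton _)]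
      rfl
  rw [hL, hR]
  refine ENNReal.tsum_le_tsum fun w => ?_
  have hterm : ∀ y, Φ w y * P x {ω | ∀ k ≤ n + 1, ω k = extendPath w y k}
      ≤ (if adj (w (Fin.last n)) y then Φ w y else 0)
        * ((2 * d : ENNReal)⁻¹ * P x {ω | pastPath n ω = w}) := by
    intro y
    have h := hP.cylinder_succ_le x n (extendPath w y)
    rw [extendPath_succ, extendPath_of_le w y le_rfl] at h
    simp only [pastPath_eq_iff y]
    change _ ≤ if adj (w (Fin.last n)) y then _ else 0 at h
    split_ifs at h ⊢ with hxy
    · gcongr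
    · rw [nonpos_iff_eq_zero.1 h]; simp
  calc _ ≤ ∑' y, (if adj (w (Fin.last n)) y then Φ w y else 0)
        * ((2 * d : ENNReal)⁻¹ * P x {ω | pastPath n ω = w}) := ENNReal.tsum_le_tsum hterm
    _ ≤ nbrSum (Φ w) (w (Fin.last n)) * ((2 * d : ENNReal)⁻¹ * P x {ω | pastPath n ω = w}) := by
        rw [ENNReal.tsum_mul_right]
        gcongr
        exact tsum_adj_le _ _
    _ = _ := by ring

lemma IsSRW.ae_start {d : ℕ} {P : Zd d → Measure (ℕ → Zd d)} (hP : IsSRW d P) (x : Zd d) :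
    ∀ᵐ ω ∂P x, ω 0 = x := by
  have := hP.1 x
  have h := hP.2.1 x 0 (fun _ => x) ⟨rfl, by simp⟩
  rw [pow_zero] at h
  have hs : {ω : ℕ → Zd d | ∀ k ≤ 0, ω k = x} = {ω | ω 0 = x} := by ext; simp
  rw [hs] at h
  refine (mem_ae_iff_prob_eq_one ?_).2 h
  exact measurableSet_eq_fun (measurable_pi_apply 0) measurable_const

open Classical in
/-- The successive visits of a path to the sets `A 0, A 1, …`: number of visits completed
by time `n`. -/
noncomputable def stage {d : ℕ} (A : ℕ → Set (Zd d)) (ω : ℕ → Zd d) : ℕ → ℕ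
  | 0 => if ω 0 ∈ A 0 then 1 else 0
  | n + 1 => if ω (n + 1) ∈ A (stage A ω n) then stage A ω n + 1 else stage A ω n

lemma stage_congr {d : ℕ} (A : ℕ → Set (Zd d)) {ω ω' : ℕ → Zd d} {n : ℕ}
    (h : ∀ k ≤ n, ω k = ω' k) : stage A ω n = stage A ω' n := by
  induction n with
  | zero => rw [stage, stage, h 0 le_rfl]
  | succ n ih => rw [stage, stage, h (n + 1) le_rfl, ih fun k hk => h k (by omega)]

lemma stage_mono {d : ℕ} (A : ℕ → Set (Zd d)) (ω : ℕ → Zd d) : Monotone (stage A ω) :=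
  monotone_nat_of_le_succ fun n => by
    rw [stage]
    split_ifs <;> omega

/-- The successive visit times underlying `stage`. -/
noncomputable def visitTime {d : ℕ} (A : ℕ → Set (Zd d)) (ω : ℕ → Zd d) : ℕ → ℕ∞
  | 0 => 0
  | s + 1 => nextIn (A s) ω (visitTime A ω s)

lemma notMem_stage {d : ℕ} {A : ℕ → Set (Zd d)} (hA : ∀ s, Disjoint (A s) (A (s + 1)))
    (ω : ℕ → Zd d) (n : ℕ) : ω n ∉ A (stage A ω n) := by
  cases n with
  | zero =>
    by_cases h : ω 0 ∈ A 0
    · simpa [stage, h] using Set.disjoint_left.1 (hA 0) h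
    · simp [stage, h]
  | succ n =>
    by_cases h : ω (n + 1) ∈ A (stage A ω n)
    · simpa [stage, h] using Set.disjoint_left.1 (hA _) h
    · simp [stage, h]

lemma le_stage_of_visitTime_le {d : ℕ} {A : ℕ → Set (Zd d)}
    (hA : ∀ s, Disjoint (A s) (A (s + 1))) (ω : ℕ → Zd d) (s n : ℕ)
    (h : visitTime A ω s ≤ n) : s ≤ stage A ω n := by
  induction s generalizing n with
  | zero => exact Nat.zero_le _
  | succ s ih =>
    have h' : visitTime A ω (s + 1) < (n + 1 : ℕ) :=
      h.trans_lt (by exact_mod_cast n.lt_succ_self)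
    rw [visitTime, nextIn, iInf_lt_iff] at h'
    obtain ⟨m, hm⟩ := h'
    rw [iInf_lt_iff] at hm
    obtain ⟨⟨hm1, hm2⟩, hm3⟩ := hm
    have hmn : m ≤ n := by
      have : m < n + 1 := by exact_mod_cast hm3
      omega
    have hs := ih m hm1
    have hne : s ≠ stage A ω m := fun he => notMem_stage hA ω m (he ▸ hm2)
    have := stage_mono A ω hmn
    omega

/-- Optional-stopping bound: a function of stage and position that does not increase on average
along the walk controls the probability that `S` visits ever occur. -/
lemma IsSRW.measure_visitTime_lt_top_le {d : ℕ} {P : Zd d → Measure (ℕ → Zd d)}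
    (hP : IsSRW d P) {A : ℕ → Set (Zd d)} (hA : ∀ s, Disjoint (A s) (A (s + 1)))
    (g : ℕ → Zd d → ENNReal) (hstep : ∀ s, ∀ y ∈ A s, g (s + 1) y ≤ g s y)
    (havg : ∀ s x, (2 * d : ENNReal)⁻¹ * nbrSum (g s) x ≤ g s x)
    {S : ℕ} (hS : ∀ s ≥ S, ∀ y, 1 ≤ g s y) {x : Zd d} (hx : x ∈ A 0) :
    P x {ω | visitTime A ω S < ⊤} ≤ g 1 x := by
  have := hP.1 x
  have hstage : ∀ n ω (y : Zd d), stage A ω n = stage A (extendPath (pastPath n ω) y) n :=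
    fun n ω y => stage_congr A ((pastPath_eq_iff y).1 rfl)
  have hbound : ∀ n, ∫⁻ ω, g (stage A ω n) (ω n) ∂P x ≤ g 1 x := by
    intro n
    induction n with
    | zero =>
      have : ∫⁻ ω, g (stage A ω 0) (ω 0) ∂P x = ∫⁻ _, g 1 x ∂P x := by
        refine lintegral_congr_ae ?_
        filter_upwards [hP.ae_start x] with ω hω
        simp [stage, hω, hx]
      simp [this]
    | succ n ih =>
      refine le_trans ?_ ih
      calc ∫⁻ ω, g (stage A ω (n + 1)) (ω (n + 1)) ∂P x
          ≤ ∫⁻ ω, g (stage A ω n) (ω (n + 1)) ∂P x := by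
            refine lintegral_mono fun ω => ?_
            simp only [stage]
            split_ifs with h
            · exact hstep _ _ h
            · exact le_rfl
        _ = ∫⁻ ω, g (stage A (extendPath (pastPath n ω) 0) n) (ω (n + 1)) ∂P x := by
            simp only [← hstage]
        _ ≤ ∫⁻ ω, (2 * d : ENNReal)⁻¹ *
              nbrSum (g (stage A (extendPath (pastPath n ω) 0) n)) (ω n) ∂P x :=
            hP.lintegral_step_le x n fun w y => g (stage A (extendPath w 0) n) y
        _ ≤ ∫⁻ ω, g (stage A ω n) (ω n) ∂P x := by
            refine lintegral_mono fun ω => ?_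
            simp only [← hstage]
            exact havg _ _
  have hmeas : ∀ n, Measurable fun ω : ℕ → Zd d => g (stage A ω n) (ω n) := by
    intro n
    have : (fun ω : ℕ → Zd d => g (stage A ω n) (ω n))
        = (fun w : Fin (n + 1) → Zd d => g (stage A (extendPath w 0) n) (w (Fin.last n)))
          ∘ pastPath n := by
      ext ω
      simp only [Function.comp, ← hstage]
      simp [pastPath]
    rw [this]
    exact (measurable_of_countable _).comp (measurable_pastPath n)
  have hsub : {ω : ℕ → Zd d | visitTime A ω S < ⊤} ⊆ ⋃ n, {ω | S ≤ stage A ω n} := by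
    intro ω hω
    obtain ⟨m, hm⟩ := ENat.ne_top_iff_exists.1 (ne_of_lt hω)
    exact Set.mem_iUnion.2 ⟨m, le_stage_of_visitTime_le hA ω S m hm.symm.le⟩
  have hmono : Monotone fun n => {ω : ℕ → Zd d | S ≤ stage A ω n} :=
    fun m n hmn ω hω => le_trans hω (stage_mono A ω hmn)
  refine (measure_mono hsub).trans ?_
  rw [hmono.measure_iUnion]
  refine iSup_le fun n => ?_
  calc P x {ω | S ≤ stage A ω n} ≤ P x {ω | 1 ≤ g (stage A ω n) (ω n)} :=
        measure_mono fun ω hω => hS _ hω _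
    _ ≤ ∫⁻ ω, g (stage A ω n) (ω n) ∂P x := by
        simpa using mul_meas_ge_le_lintegral (μ := P x) (hmeas n) 1
    _ ≤ g 1 x := hbound n

lemma nbrSum_const_mul {d : ℕ} (a : ENNReal) (h : Zd d → ENNReal) (x : Zd d) :
    nbrSum (fun y => a * h y) x = a * nbrSum h x := by
  simp only [nbrSum, Finset.mul_sum, mul_add]

lemma average_one_le {d : ℕ} (x : Zd d) : (2 * d : ENNReal)⁻¹ * nbrSum (fun _ => 1) x ≤ 1 := by
  have : nbrSum (fun _ => 1) x = (2 * d : ENNReal) := by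
    simp only [nbrSum, Finset.sum_const, Finset.card_univ, Fintype.card_fin, nsmul_eq_mul,
      one_add_one_eq_two, mul_comm]
  rw [this]
  exact ENNReal.inv_mul_le_one _

/-- The targets visited alternately: `V` at even stages, the complement of `U` at odd ones. -/
def altTarget {d : ℕ} (V U : Set (Zd d)) (s : ℕ) : Set (Zd d) := if Even s then V else Uᶜ

lemma RD_snd_eq_visitTime {d : ℕ} (V U : Set (Zd d)) (ω : ℕ → Zd d) (k : ℕ) :
    (RD V U ω k).2 = visitTime (altTarget V U) ω (2 * k) := by
  induction k with
  | zero => rfl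
  | succ k ih =>
    have h0 : altTarget V U (2 * k) = V := if_pos (by simp)
    have h1 : altTarget V U (2 * k + 1) = Uᶜ := if_neg (by simp)
    rw [show 2 * (k + 1) = 2 * k + 1 + 1 by ring, visitTime, visitTime, h0, h1, ← ih]
    rfl

lemma RD_fst_eq_visitTime {d : ℕ} (V U : Set (Zd d)) (ω : ℕ → Zd d) (k : ℕ) :
    (RD V U ω (k + 1)).1 = visitTime (altTarget V U) ω (2 * k + 1) := by
  have h0 : altTarget V U (2 * k) = V := if_pos (by simp)
  rw [visitTime, h0, ← RD_snd_eq_visitTime]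
  rfl

/-- If `F` is superharmonic, at least `1` on `V` and at most `p` off `U`, then the walk started
in `V` returns `r` times after leaving `U` with probability at most `p ^ r`. -/
lemma IsSRW.measure_return_le {d : ℕ} {P : Zd d → Measure (ℕ → Zd d)} (hP : IsSRW d P)
    {V U : Set (Zd d)} (hVU : V ⊆ U) {F : Zd d → ENNReal} {p : ENNReal}
    (hF : ∀ x, (2 * d : ENNReal)⁻¹ * nbrSum F x ≤ F x) (hV : ∀ x ∈ V, 1 ≤ F x)
    (hU : ∀ x ∉ U, F x ≤ p) (r : ℕ) {x : Zd d} (hx : x ∈ V) :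
    P x {ω | (RD V U ω (r + 1)).1 < (⊤ : ℕ∞)} ≤ p ^ r := by
  simp only [RD_fst_eq_visitTime]
  have hdisj : ∀ s, Disjoint (altTarget V U s) (altTarget V U (s + 1)) := by
    intro s
    have h := Set.disjoint_compl_right_iff_subset.2 hVU
    by_cases hs : Even s
    · simpa [altTarget, hs, Nat.even_add_one] using h
    · simpa [altTarget, hs, Nat.even_add_one] using h.symm
  set g : ℕ → Zd d → ENNReal := fun s y =>
    if 2 * r + 1 ≤ s then 1 else p ^ (r - s / 2) * (if Even s then F y else 1) with hg
  have hbig : ∀ s y, 2 * r + 1 ≤ s → g s y = 1 := fun s y h => if_pos h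
  have hlow : ∀ s y, ¬ 2 * r + 1 ≤ s → g s y = p ^ (r - s / 2) * (if Even s then F y else 1) :=
    fun s y h => if_neg h
  have hmain := hP.measure_visitTime_lt_top_le hdisj g ?_ ?_ (S := 2 * r + 1) ?_
    (x := x) (by simpa [altTarget] using hx)
  · refine hmain.trans ?_
    simp only [hg]
    split_ifs with h1 h2
    · obtain rfl : r = 0 := by omega
      simp
    · exact absurd h2 (by decide)
    · simp
  · intro s y hy
    by_cases h1 : 2 * r + 1 ≤ s
    · rw [hbig _ _ h1, hbig _ _ (by omega)]
    · by_cases hs : Even s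
      · have hyV : 1 ≤ F y := hV y (by simpa [altTarget, hs] using hy)
        obtain ⟨j, rfl⟩ := hs
        rw [← two_mul] at *
        have hgs : g (2 * j) y = p ^ (r - j) * F y := by
          simp [hlow _ y h1]
        have hgs' : g (2 * j + 1) y = p ^ (r - j) := by
          by_cases h2 : 2 * r + 1 ≤ 2 * j + 1
          · rw [hbig _ y h2, show r - j = 0 by omega, pow_zero]
          · simp [hlow _ y h2, show (2 * j + 1) / 2 = j by omega]
        rw [hgs, hgs']
        exact le_mul_of_one_le_right' hyV
      · have hyU : F y ≤ p := hU y (by simpa [altTarget, hs] using hy)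
        obtain ⟨j, rfl⟩ := Nat.not_even_iff_odd.1 hs
        have hgs : g (2 * j + 1) y = p ^ (r - j) := by
          simp [hlow _ y h1, show (2 * j + 1) / 2 = j by omega]
        have hgs' : g (2 * j + 1 + 1) y = p ^ (r - (j + 1)) * F y := by
          have : Even (2 * j + 1 + 1) := ⟨j + 1, by ring⟩
          rw [hlow _ y (by omega), if_pos this, show (2 * j + 1 + 1) / 2 = j + 1 by omega]
        rw [hgs, hgs', show r - j = r - (j + 1) + 1 by omega, pow_succ]
        gcongr
  · intro s y
    by_cases h1 : 2 * r + 1 ≤ s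
    · simpa only [hg, h1, if_true] using average_one_le y
    · simp only [hg, h1, if_false]
      rw [nbrSum_const_mul, mul_left_comm]
      gcongr
      by_cases hs : Even s
      · simpa only [hs, if_true] using hF y
      · simpa only [hs, if_false] using average_one_le y
  · intro s hs y
    exact (hbig s y hs).ge

lemma potential_pos {d : ℕ} (hd : 3 ≤ d) (x : Zd d) : 0 < potential x :=
  Real.rpow_pos_of_pos (add_pos_of_nonneg_of_pos (nsq_nonneg x) (regConst_pos hd)) _

lemma average_ofReal_potential_le {d : ℕ} (hd : 3 ≤ d) (c : Zd d) (a : ENNReal) (x : Zd d) :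
    (2 * d : ENNReal)⁻¹ * nbrSum (fun y => a * ENNReal.ofReal (potential (y - c))) x
      ≤ a * ENNReal.ofReal (potential (x - c)) := by
  rw [nbrSum_const_mul, mul_left_comm]
  gcongr
  have hsum : nbrSum (fun y => ENNReal.ofReal (potential (y - c))) x
      = ENNReal.ofReal (∑ i, (potential (x - c + Pi.single i 1)
        + potential (x - c + Pi.single i (-1)))) := by
    rw [ENNReal.ofReal_sum_of_nonneg fun i _ =>
      add_nonneg (potential_pos hd _).le (potential_pos hd _).le]
    refine Finset.sum_congr rfl fun i _ => ?_
    rw [ENNReal.ofReal_add (potential_pos hd _).le (potential_pos hd _).le]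
    simp only [add_sub_right_comm]
  have hd0 : (d : ENNReal) ≠ 0 := by simp; omega
  rw [hsum, ENNReal.inv_mul_le_iff (by simpa using hd0) (by finiteness)]
  refine (ENNReal.ofReal_le_ofReal (potential_superharmonic hd (x - c))).trans_eq ?_
  rw [ENNReal.ofReal_mul (by positivity), ENNReal.ofReal_mul (by positivity)]
  simp

/-- Lower bound for `potential` on the ball of radius `3L`. -/
noncomputable def ballValue (d L : ℕ) : ℝ := (9 * d * (L : ℝ) ^ 2 + regConst d) ^ (-sExp d)

lemma ballValue_pos {d : ℕ} (hd : 3 ≤ d) (L : ℕ) : 0 < ballValue d L := by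
  have := regConst_pos hd
  unfold ballValue
  positivity

lemma ballValue_le_potential {d : ℕ} (hd : 3 ≤ d) {L : ℕ} {x : Zd d}
    (hx : ∀ j, |x j| ≤ 3 * (L : ℤ)) : ballValue d L ≤ potential x := by
  have hA := regConst_pos hd
  have hn : nsq x ≤ 9 * d * (L : ℝ) ^ 2 := by
    have : nsq x ≤ ∑ _j : Fin d, 9 * (L : ℝ) ^ 2 := by
      refine Finset.sum_le_sum fun j _ => ?_
      have h : |(x j : ℝ)| ≤ 3 * L := by exact_mod_cast hx j
      rw [← sq_abs]
      nlinarith [abs_nonneg (x j : ℝ)]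
    refine this.trans_eq ?_
    simp; ring
  exact Real.rpow_le_rpow_of_nonpos (add_pos_of_nonneg_of_pos (nsq_nonneg x) hA) (by linarith)
    (neg_nonpos.2 (sExp_pos hd).le)

lemma potential_div_ballValue_le {d : ℕ} (hd : 3 ≤ d) {L l : ℕ} (hL : 1 ≤ L) (hl : 1 ≤ l)
    {x : Zd d} {j : Fin d} (hx : ((l * L : ℕ) : ℤ) < 10 * |x j|) :
    potential x / ballValue d L ≤ (100 * (9 * d + regConst d)) ^ sExp d / (l : ℝ) ^ (d - 2) := by
  have hA := regConst_pos hd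
  have hs := sExp_pos hd
  have hL1 : (1 : ℝ) ≤ L := by exact_mod_cast hL
  have hl1 : (1 : ℝ) ≤ l := by exact_mod_cast hl
  have hn : ((l : ℝ) * L / 10) ^ 2 ≤ nsq x + regConst d := by
    have h : (l : ℝ) * L < 10 * |(x j : ℝ)| := by exact_mod_cast hx
    have h2 := sq_le_nsq x j
    have h3 : ((l : ℝ) * L / 10) ^ 2 ≤ |(x j : ℝ)| ^ 2 :=
      pow_le_pow_left₀ (by positivity) (by linarith) 2
    rw [sq_abs] at h3
    linarith
  have hpow : (l : ℝ) ^ (d - 2) = ((l : ℝ) ^ 2) ^ sExp d := by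
    rw [← Real.rpow_natCast _ 2, ← Real.rpow_mul (by positivity), ← Real.rpow_natCast,
      Nat.cast_sub (by omega), sExp]
    congr 1
    push_cast
    ring
  have hq : 0 < nsq x + regConst d := add_pos_of_nonneg_of_pos (nsq_nonneg x) hA
  have hb : 0 < 9 * d * (L : ℝ) ^ 2 + regConst d := by positivity
  rw [potential, ballValue, Real.rpow_neg hq.le, Real.rpow_neg hb.le, inv_div_inv, hpow,
    ← Real.div_rpow hb.le hq.le, ← Real.div_rpow (by positivity) (by positivity)]
  refine Real.rpow_le_rpow (by positivity) ?_ hs.le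
  rw [div_le_div_iff₀ hq (by positivity)]
  calc (9 * d * (L : ℝ) ^ 2 + regConst d) * (l : ℝ) ^ 2
      ≤ (9 * d * (L : ℝ) ^ 2 + regConst d * (L : ℝ) ^ 2) * (l : ℝ) ^ 2 := by
        gcongr
        exact le_mul_of_one_le_right hA.le (one_le_pow₀ hL1)
    _ = 100 * (9 * d + regConst d) * ((l : ℝ) * L / 10) ^ 2 := by ring
    _ ≤ _ := by gcongr

/-- The centre `2 L i` of one of the boxes. -/
def boxCenter (d L : ℕ) (i : ℤ × ℤ) : Zd d := fun j => 2 * (L : ℤ) * embPlane d i j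

lemma subset_nbhdU {d : ℕ} (L1 : ℕ) (V : Set (Zd d)) : V ⊆ nbhdU d L1 V :=
  fun v hv => ⟨v, hv, by simp⟩

lemma ellOf_pos (L : ℕ) : 1 ≤ ellOf L := Nat.le_add_left _ _

lemma Lseq_pos {L0 : ℕ} (h : 1 ≤ L0) (n : ℕ) : 1 ≤ Lseq L0 n := by
  induction n with
  | zero => exact h
  | succ n ih => exact Nat.mul_pos (ellOf_pos _) ih

/-- The return probability bound for the two-box set at scale `L`. -/
lemma IsSRW.measure_return_twoBox_le {d : ℕ} (hd : 3 ≤ d) {P : Zd d → Measure (ℕ → Zd d)}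
    (hP : IsSRW d P) {L l : ℕ} (hL : 1 ≤ L) (hl : 1 ≤ l) (i1 i2 : ℤ × ℤ) (r : ℕ) {x : Zd d}
    (hx : x ∈ twoBoxV d L i1 i2) :
    P x {ω | (RD (twoBoxV d L i1 i2) (nbhdU d (l * L) (twoBoxV d L i1 i2)) ω (r + 1)).1
      < (⊤ : ℕ∞)} ≤
      ENNReal.ofReal (2 * (100 * (9 * d + regConst d)) ^ sExp d / (l : ℝ) ^ (d - 2)) ^ r := by
  have hA := regConst_pos hd
  have hb := ballValue_pos hd L
  set a : ENNReal := ENNReal.ofReal (ballValue d L)⁻¹ with ha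
  have haof : ∀ y : Zd d, a * ENNReal.ofReal (potential y)
      = ENNReal.ofReal (potential y / ballValue d L) := fun y => by
    rw [ha, ← ENNReal.ofReal_mul (by positivity), mul_comm, div_eq_mul_inv]
  have hone : ∀ (y c : Zd d), (∀ j, |y j - c j| ≤ 3 * (L : ℤ)) →
      1 ≤ a * ENNReal.ofReal (potential (y - c)) := by
    intro y c hy
    rw [haof, ← ENNReal.ofReal_one]
    exact ENNReal.ofReal_le_ofReal ((one_le_div hb).2 (ballValue_le_potential hd hy))
  have hfar : ∀ y c : Zd d, y ∉ nbhdU d (l * L) (twoBoxV d L i1 i2) → c ∈ twoBoxV d L i1 i2 →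
      a * ENNReal.ofReal (potential (y - c))
        ≤ ENNReal.ofReal ((100 * (9 * d + regConst d)) ^ sExp d / (l : ℝ) ^ (d - 2)) := by
    intro y c hy hc
    have : ∃ j, ((l * L : ℕ) : ℤ) < 10 * |(y - c) j| := by
      by_contra! h
      exact hy ⟨c, hc, h⟩
    obtain ⟨j, hj⟩ := this
    rw [haof]
    exact ENNReal.ofReal_le_ofReal (potential_div_ballValue_le hd hL hl hj)
  have hc1 : boxCenter d L i1 ∈ twoBoxV d L i1 i2 := Or.inl fun j => by simp [boxCenter]
  have hc2 : boxCenter d L i2 ∈ twoBoxV d L i1 i2 := Or.inr fun j => by simp [boxCenter]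
  refine hP.measure_return_le (subset_nbhdU _ _)
    (F := fun y => a * ENNReal.ofReal (potential (y - boxCenter d L i1))
      + a * ENNReal.ofReal (potential (y - boxCenter d L i2))) ?_ ?_ ?_ r hx
  · intro y
    have hadd : ∀ f g : Zd d → ENNReal, nbrSum (fun z => f z + g z) y
        = nbrSum f y + nbrSum g y := fun f g => by
      simp only [nbrSum, ← Finset.sum_add_distrib]
      exact Finset.sum_congr rfl fun i _ => by ring
    rw [hadd, mul_add]
    exact add_le_add (average_ofReal_potential_le hd _ a y) (average_ofReal_potential_le hd _ a y)
  · rintro y (hy | hy)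
    · exact (hone y (boxCenter d L i1) hy).trans le_self_add
    · exact (hone y (boxCenter d L i2) hy).trans le_add_self
  · intro y hy
    refine (add_le_add (hfar y _ hy hc1) (hfar y _ hy hc2)).trans_eq ?_
    rw [← ENNReal.ofReal_add (by positivity) (by positivity)]
    congr 1
    ring

end RI

/-- **Bound on the mass of trajectories with many returns** ((2.30)).
With `V` the union of the two boxes and `U` its neighbourhood as in Proposition 2.1,
for every `r ≥ 1`: `Σ_x e_V(x) P_x[R_{r+1} < ∞] ≤ cap(V) (c₃/ℓ_n^{d-2})^r`. -/
theorem many_returns_bound (d : ℕ) (hd : 3 ≤ d) :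
    ∃ c3 c' : ℝ, 0 < c3 ∧ 0 < c' ∧
      ∀ L0 : ℕ, c' ≤ (L0 : ℝ) → ∀ n : ℕ, ∀ r : ℕ, 1 ≤ r → ∀ i1 i2 : ℤ × ℤ,
        max |i1.1| |i1.2| = ((ellOf (Lseq L0 n) : ℤ) - 1) / 2 →
        max |i2.1| |i2.2| = (ellOf (Lseq L0 n) : ℤ) →
        ∀ (P : Zd d → Measure (ℕ → Zd d)), IsSRW d P →
          (∑ x ∈ twoBoxVF d (Lseq L0 n) i1 i2,
              eqm P (twoBoxV d (Lseq L0 n) i1 i2) x *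
                (P x {ω | (RD (twoBoxV d (Lseq L0 n) i1 i2)
                    (nbhdU d (Lseq L0 (n + 1)) (twoBoxV d (Lseq L0 n) i1 i2))
                    ω (r + 1)).1 < (⊤ : ℕ∞)}).toReal) ≤
            (∑ x ∈ twoBoxVF d (Lseq L0 n) i1 i2,
                eqm P (twoBoxV d (Lseq L0 n) i1 i2) x) *
              (c3 / (ellOf (Lseq L0 n) : ℝ) ^ (d - 2)) ^ r := by
  have hA := regConst_pos hd
  refine ⟨2 * (100 * (9 * d + regConst d)) ^ sExp d, 1, by positivity, one_pos, ?_⟩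
  intro L0 hL0 n r _ i1 i2 _ _ P hP
  have hL := Lseq_pos (L0 := L0) (by exact_mod_cast hL0) n
  rw [Finset.sum_mul]
  refine Finset.sum_le_sum fun x _ => ?_
  by_cases hx : x ∈ twoBoxV d (Lseq L0 n) i1 i2
  · refine mul_le_mul_of_nonneg_left ?_ (Set.indicator_nonneg (fun _ _ => ENNReal.toReal_nonneg) x)
    refine ENNReal.toReal_le_of_le_ofReal (by positivity) ?_
    rw [ENNReal.ofReal_pow (by positivity)]
    exact hP.measure_return_twoBox_le hd hL (ellOf_pos _) i1 i2 r hx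
  · simp [eqm, hx]
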